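/- arXiv:1503.07856 — 4 statements merged into one kernel-verified Lean document; each statement's English description precedes it below -/
import Mathlib

section
/- Let A be a Hankel weighing matrix of order n and weight k. Then for every i with 2 ≤ i ≤ n, the absolute values satisfy |a_{i,1}| = |a_{i-1,n}|; that is, a_{i-1,n} = ε_i · a_{i,1} for some sign ε_i ∈ {1, -1}. -/
open Matrix

/-- An `n × n` integer matrix with entries in `{0, 1, -1}` is a weighing matrix of
order `n` and weight `k` if `A * Aᵀ = k • I`. -/
def IsWeighingMatrix {n : ℕ} (A : Matrix (Fin n) (Fin n) ℤ) (k : ℕ) : Prop :=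
  (∀ i j, A i j = 0 ∨ A i j = 1 ∨ A i j = -1) ∧
    A * Aᵀ = (k : ℤ) • (1 : Matrix (Fin n) (Fin n) ℤ)

/-- A matrix has constant diagonals (is "Hankel" in the sense of the paper) if
`a_{i,j} = a_{i-1,j-1}` for all `2 ≤ i, j ≤ n` (here stated with 0-based indices). -/
def HasConstantDiagonals {n : ℕ} (A : Matrix (Fin n) (Fin n) ℤ) : Prop :=
  ∀ (i j : Fin n) (hi : i.val + 1 < n) (hj : j.val + 1 < n),
    A ⟨i.val + 1, hi⟩ ⟨j.val + 1, hj⟩ = A i j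

/-- For a Hankel weighing matrix, `|a_{i,1}| = |a_{i-1,n}|` for all `2 ≤ i ≤ n`;
that is, `a_{i-1,n} = ε_i · a_{i,1}` for some sign `ε_i ∈ {1, -1}`. -/
theorem hankel_weighing_wraparound_abs {n k : ℕ} (A : Matrix (Fin n) (Fin n) ℤ)
    (hA : IsWeighingMatrix A k) (hH : HasConstantDiagonals A) :
    ∀ (i : Fin n) (hi : i.val + 1 < n),
      |A ⟨i.val + 1, hi⟩ ⟨0, by omega⟩| = |A i ⟨n - 1, by omega⟩| ∧
      ∃ ε : ℤ, (ε = 1 ∨ ε = -1) ∧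
        A i ⟨n - 1, by omega⟩ = ε * A ⟨i.val + 1, hi⟩ ⟨0, by omega⟩ := by
  obtain ⟨-, hk⟩ := hA
  intro i hi
  have row : ∀ r : Fin n, ∑ j, A r j * A r j = (k : ℤ) := by
    intro r
    have h := congrFun (congrFun hk r) r
    simpa [Matrix.mul_apply] using h
  have hsq : A i ⟨n - 1, by omega⟩ ^ 2 = A ⟨i.val + 1, hi⟩ ⟨0, by omega⟩ ^ 2 := by
    obtain ⟨m, rfl⟩ : ∃ m, n = m + 1 := ⟨n - 1, by omega⟩
    have h1 := row i
    have h2 := row ⟨i.val + 1, hi⟩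
    rw [Fin.sum_univ_castSucc] at h1
    rw [Fin.sum_univ_succ] at h2
    have h3 : ∀ j : Fin m, A ⟨i.val + 1, hi⟩ j.succ = A i j.castSucc := fun j =>
      hH i j.castSucc hi (Nat.succ_lt_succ j.isLt)
    simp only [h3] at h2
    have e1 : (⟨m + 1 - 1, by omega⟩ : Fin (m + 1)) = Fin.last m := rfl
    have e2 : (⟨0, by omega⟩ : Fin (m + 1)) = 0 := rfl
    rw [e1, e2]
    linarith
  refine ⟨((sq_eq_sq_iff_abs_eq_abs _ _).1 hsq).symm, ?_⟩
  rcases sq_eq_sq_iff_eq_or_eq_neg.1 hsq with h | h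
  · exact ⟨1, Or.inl rfl, by rw [h, one_mul]⟩
  · exact ⟨-1, Or.inr rfl, by rw [h, neg_one_mul]⟩
end

section
/- Let A be a Hankel weighing matrix of order n and weight k. Then for all i, t with 2 ≤ i, t ≤ n, we have a_{i,1} · a_{t,1} = a_{i-1,n} · a_{t-1,n}. -/
open Matrix

/-- For a Hankel weighing matrix, `a_{i,1} · a_{t,1} = a_{i-1,n} · a_{t-1,n}`
for all `2 ≤ i, t ≤ n`. -/
theorem hankel_weighing_wraparound_prod {n k : ℕ} (A : Matrix (Fin n) (Fin n) ℤ)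
    (hA : IsWeighingMatrix A k) (hH : HasConstantDiagonals A) :
    ∀ (i t : Fin n) (hi : i.val + 1 < n) (ht : t.val + 1 < n),
      A ⟨i.val + 1, hi⟩ ⟨0, by omega⟩ * A ⟨t.val + 1, ht⟩ ⟨0, by omega⟩ =
        A i ⟨n - 1, by omega⟩ * A t ⟨n - 1, by omega⟩ := by
  intro i t hi ht
  obtain ⟨-, hM⟩ := hA
  obtain _ | m := n
  · exact i.elim0
  have row : ∀ a b : Fin (m + 1), ∑ j, A a j * A b j = if a = b then (k : ℤ) else 0 := by
    intro a b
    have h := congrFun (congrFun hM a) b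
    simpa [Matrix.mul_apply, Matrix.one_apply] using h
  have h1 := row ⟨i.val + 1, hi⟩ ⟨t.val + 1, ht⟩
  have h2 := row i t
  rw [Fin.sum_univ_succ] at h1
  rw [Fin.sum_univ_castSucc] at h2
  have hs : ∀ (a : Fin (m + 1)) (ha : a.val + 1 < m + 1) (j : Fin m),
      A ⟨a.val + 1, ha⟩ j.succ = A a j.castSucc := fun a ha j =>
    hH a j.castSucc ha (Nat.succ_lt_succ j.isLt)
  simp only [hs] at h1
  have he : ((⟨i.val + 1, hi⟩ : Fin (m + 1)) = ⟨t.val + 1, ht⟩) ↔ i = t := by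
    simp [Fin.ext_iff]
  simp only [he] at h1
  rw [← h2] at h1
  have h3 : A ⟨i.val + 1, hi⟩ 0 * A ⟨t.val + 1, ht⟩ 0 =
      A i (Fin.last m) * A t (Fin.last m) := by linarith
  exact h3
end

section
/- Let A be a Hankel weighing matrix of order n and weight k. Then exactly one of the following uniform sign conditions holds across all wraparound positions: either a_{i,1} = a_{i-1,n} for every i with 2 ≤ i ≤ n, or a_{i,1} = -a_{i-1,n} for every i with 2 ≤ i ≤ n. -/
open Matrix

/-- For a Hankel weighing matrix, a uniform sign condition holds across all
wraparound positions: either `a_{i,1} = a_{i-1,n}` for every `2 ≤ i ≤ n`, or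
`a_{i,1} = -a_{i-1,n}` for every `2 ≤ i ≤ n`. -/
theorem hankel_weighing_uniform_sign {n k : ℕ} (A : Matrix (Fin n) (Fin n) ℤ)
    (hA : IsWeighingMatrix A k) (hH : HasConstantDiagonals A) :
    (∀ (i : Fin n) (hi : i.val + 1 < n),
        A ⟨i.val + 1, hi⟩ ⟨0, by omega⟩ = A i ⟨n - 1, by omega⟩) ∨
    (∀ (i : Fin n) (hi : i.val + 1 < n),
        A ⟨i.val + 1, hi⟩ ⟨0, by omega⟩ = -A i ⟨n - 1, by omega⟩) := by
  have key : ∀ (i j : Fin n) (hi : i.val + 1 < n) (hj : j.val + 1 < n),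
      A ⟨i.val + 1, hi⟩ ⟨0, by omega⟩ * A ⟨j.val + 1, hj⟩ ⟨0, by omega⟩ =
        A i ⟨n - 1, by omega⟩ * A j ⟨n - 1, by omega⟩ := by
    intro i j hi hj
    obtain ⟨m, rfl⟩ : ∃ m, n = m + 1 := ⟨n - 1, by omega⟩
    have e1 := congrFun (congrFun hA.2 ⟨i.val + 1, hi⟩) ⟨j.val + 1, hj⟩
    have e2 := congrFun (congrFun hA.2 i) j
    rw [Matrix.mul_apply] at e1 e2
    simp only [Matrix.transpose_apply, Matrix.smul_apply, Matrix.one_apply] at e1 e2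
    rw [Fin.sum_univ_succ] at e1
    rw [Fin.sum_univ_castSucc] at e2
    have h3 : ∑ c : Fin m, A ⟨i.val + 1, hi⟩ c.succ * A ⟨j.val + 1, hj⟩ c.succ =
        ∑ c : Fin m, A i c.castSucc * A j c.castSucc := by
      refine Finset.sum_congr rfl fun c _ => ?_
      have a1 := hH i c.castSucc hi (by simp)
      have a2 := hH j c.castSucc hj (by simp)
      rw [← a1, ← a2]
      rfl
    have h4 : ((⟨i.val + 1, hi⟩ : Fin (m + 1)) = ⟨j.val + 1, hj⟩) ↔ i = j := by
      simp [Fin.ext_iff]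
    simp only [h4] at e1
    rw [h3, ← e2, add_comm] at e1
    exact add_left_cancel e1
  by_cases h : ∃ (j : Fin n) (_ : j.val + 1 < n), A j ⟨n - 1, by omega⟩ ≠ 0
  · obtain ⟨j, hj, hne⟩ := h
    rcases mul_self_eq_mul_self_iff.mp (key j j hj hj) with h1 | h1
    · left
      intro i hi
      have := key i j hi hj
      rw [h1] at this
      exact mul_right_cancel₀ hne this
    · right
      intro i hi
      have := key i j hi hj
      rw [h1] at this
      exact mul_right_cancel₀ hne (by linarith)
  · left
    intro i hi
    have h0 : A i ⟨n - 1, by omega⟩ = 0 := by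
      by_contra hc
      exact h ⟨i, hi, hc⟩
    have := key i i hi hi
    rw [h0] at this ⊢
    simpa using this
end

section
/- Every Hankel weighing matrix of order n and weight k is either a circulant weighing matrix or a negacyclic weighing matrix. That is, if A is a HW(n,k), then either (a_{i,j} = a_{i-1,j-1} for all 2 ≤ i,j ≤ n and a_{i,1} = a_{i-1,n} for all 2 ≤ i ≤ n), so that each row of A is the right cyclic shift of the row above it, or (a_{i,j} = a_{i-1,j-1} for all 2 ≤ i,j ≤ n and a_{i,1} = -a_{i-1,n} for all 2 ≤ i ≤ n), so that A is a polynomial in the n×n negacyclic shift matrix Y. -/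
open Matrix

/-- A matrix is circulant if each row after the first is the right cyclic shift of
the row above it: `a_{i,j} = a_{i-1,j-1}` for `2 ≤ i, j ≤ n` and `a_{i,1} = a_{i-1,n}`
for `2 ≤ i ≤ n`. -/
def IsCirculantMatrix {n : ℕ} (A : Matrix (Fin n) (Fin n) ℤ) : Prop :=
  HasConstantDiagonals A ∧
    ∀ (i : Fin n) (hi : i.val + 1 < n),
      A ⟨i.val + 1, hi⟩ ⟨0, by omega⟩ = A i ⟨n - 1, by omega⟩

/-- A matrix is negacyclic if `a_{i,j} = a_{i-1,j-1}` for `2 ≤ i, j ≤ n` and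
`a_{i,1} = -a_{i-1,n}` for `2 ≤ i ≤ n` (equivalently, it is a polynomial in the
negacyclic shift matrix `Y`). -/
def IsNegacyclicMatrix {n : ℕ} (A : Matrix (Fin n) (Fin n) ℤ) : Prop :=
  HasConstantDiagonals A ∧
    ∀ (i : Fin n) (hi : i.val + 1 < n),
      A ⟨i.val + 1, hi⟩ ⟨0, by omega⟩ = -A i ⟨n - 1, by omega⟩

/-- Every Hankel weighing matrix is either a circulant weighing matrix or a
negacyclic weighing matrix. -/
theorem hankel_weighing_circulant_or_negacyclic {n k : ℕ}
    (A : Matrix (Fin n) (Fin n) ℤ)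
    (hA : IsWeighingMatrix A k) (hH : HasConstantDiagonals A) :
    IsCirculantMatrix A ∨ IsNegacyclicMatrix A := by
  obtain ⟨-, hW⟩ := hA
  rcases n with _ | m
  · exact Or.inl ⟨hH, fun i => i.elim0⟩
  -- the outer products of the first column (shifted) and the last column agree
  have key : ∀ (i j : Fin (m + 1)) (hi : i.val + 1 < m + 1) (hj : j.val + 1 < m + 1),
      A ⟨i.val + 1, hi⟩ 0 * A ⟨j.val + 1, hj⟩ 0
        = A i (Fin.last m) * A j (Fin.last m) := by
    intro i j hi hj
    have h1 := congrFun (congrFun hW ⟨i.val + 1, hi⟩) ⟨j.val + 1, hj⟩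
    have h2 := congrFun (congrFun hW i) j
    have h3 : ((k : ℤ) • (1 : Matrix (Fin (m + 1)) (Fin (m + 1)) ℤ))
          ⟨i.val + 1, hi⟩ ⟨j.val + 1, hj⟩
        = ((k : ℤ) • (1 : Matrix (Fin (m + 1)) (Fin (m + 1)) ℤ)) i j := by
      simp [Matrix.one_apply, Fin.ext_iff]
    rw [h3, ← h2, Matrix.mul_apply, Matrix.mul_apply, Fin.sum_univ_succ,
      Fin.sum_univ_castSucc (n := m)] at h1
    simp only [Matrix.transpose_apply] at h1
    have h4 : ∀ (r : Fin (m + 1)) (hr : r.val + 1 < m + 1) (l : Fin m),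
        A ⟨r.val + 1, hr⟩ l.succ = A r l.castSucc := by
      intro r hr l
      exact hH r l.castSucc hr (by simp)
    simp only [h4] at h1
    linarith
  by_cases hc : ∀ (i : Fin (m + 1)) (hi : i.val + 1 < m + 1),
      A ⟨i.val + 1, hi⟩ 0 = A i (Fin.last m)
  · exact Or.inl ⟨hH, hc⟩
  · right
    refine ⟨hH, ?_⟩
    push Not at hc
    obtain ⟨p, hp, hne⟩ := hc
    intro j hj
    change A ⟨j.val + 1, hj⟩ 0 = -A j (Fin.last m)
    have hpp := key p p hp hp
    have hpj := key p j hp hj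
    have hneg : A ⟨p.val + 1, hp⟩ 0 = -A p (Fin.last m) :=
      (mul_self_eq_mul_self_iff.mp hpp).resolve_left hne
    have h0 : A p (Fin.last m) ≠ 0 := by
      intro h
      apply hne
      rw [hneg, h, neg_zero]
    rw [hneg] at hpj
    apply mul_left_cancel₀ h0
    linarith
end
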